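/- Let G and G' be games over a poset A, and let H and H' be games over a poset B. Then: (A) if G ≤ G' and H ≤ H', then G+H ≤ G'+H'; (B) if G ◁ G' and H ≤ H', then G+H ◁ G'+H'; (C) if G ≤ G' and H ◁ H', then G+H ◁ G'+H'. Here G+H and G'+H' are games over the product poset A×B. -/

import Mathlib

/-- Games over a poset `α`: atomic games `[a]` for `a : α`, and composite games
`⟨L|R⟩` given by nonempty families of left and right options. -/
inductive Game (α : Type) : Type 1 where
  | atom : α → Game α
  | comp : (ι κ : Type) → (ι → Game α) → (κ → Game α) → Nonempty ι → Nonempty κ → Game α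

namespace Game

variable {α β : Type}

/-- `G'` is a left option of the game. -/
def IsLeftOption (G' : Game α) : Game α → Prop
  | atom _ => False
  | comp _ _ L _ _ _ => ∃ i, L i = G'

/-- `G'` is a right option of the game. -/
def IsRightOption (G' : Game α) : Game α → Prop
  | atom _ => False
  | comp _ _ _ R _ _ => ∃ k, R k = G'

/-- `G'` is an option of `G`. -/
def IsOption (G' G : Game α) : Prop := IsLeftOption G' G ∨ IsRightOption G' G

/-- A game is composite if it is not atomic. -/
def IsComposite : Game α → Prop
  | atom _ => False
  | comp _ _ _ _ _ _ => True

/-- `G'` is a follower of `G`: `G` itself, an option of `G`, or recursively a follower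
of an option of `G`. -/
def IsFollower (G' G : Game α) : Prop := Relation.ReflTransGen IsOption G' G

/-- The dual game: Left and Right switch sides; it is a game over the opposite poset. -/
def dual : Game α → Game αᵒᵈ
  | atom a => atom (OrderDual.toDual a)
  | comp ι κ L R hι hκ => comp κ ι (fun k => (R k).dual) (fun i => (L i).dual) hκ hι

/-- The image of a game under a (monotone) function applied to atoms. -/
def map (f : α → β) : Game α → Game β
  | atom a => atom (f a)
  | comp ι κ L R hι hκ => comp ι κ (fun i => (L i).map f) (fun k => (R k).map f) hι hκ

/-- The (disjunctive) sum of a game over `α` and a game over `β`, a game over `α × β`. -/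
noncomputable def add : Game α → Game β → Game (α × β) := by
  intro G
  induction G with
  | atom g =>
    intro H
    induction H with
    | atom h => exact atom (g, h)
    | comp ι κ L R hι hκ IHL IHR => exact comp ι κ IHL IHR hι hκ
  | comp ι κ L R hι hκ IHL IHR =>
    intro H
    induction H with
    | atom h => exact comp ι κ (fun i => IHL i (atom h)) (fun k => IHR k (atom h)) hι hκ
    | comp ι' κ' L' R' hι' hκ' IHL' IHR' =>
      exact comp (ι ⊕ ι') (κ ⊕ κ')
        (Sum.elim (fun i => IHL i (comp ι' κ' L' R' hι' hκ')) IHL')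
        (Sum.elim (fun k => IHR k (comp ι' κ' L' R' hι' hκ')) IHR')
        (hι.elim fun i => ⟨Sum.inl i⟩) (hκ.elim fun k => ⟨Sum.inl k⟩)

mutual
/-- Left has a first player winning strategy in a game over the boolean poset:
either the game is the atom `⊤`, or some left option has a second player
winning strategy for Left. -/
inductive LeftWinsFirst : Game Bool → Prop where
  | atom_top : LeftWinsFirst (atom true)
  | move {G G' : Game Bool} : IsLeftOption G' G → LeftWinsSecond G' → LeftWinsFirst G

/-- Left has a second player winning strategy in a game over the boolean poset:
every right option has a first player winning strategy for Left, and if the game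
is atomic it is the atom `⊤`. -/
inductive LeftWinsSecond : Game Bool → Prop where
  | mk {G : Game Bool} : (∀ G', IsRightOption G' G → LeftWinsFirst G') →
      (∀ b, G = atom b → b = true) → LeftWinsSecond G
end

mutual
/-- A game is even if all of its options are odd (atomic games are even). -/
inductive Even {α : Type} : Game α → Prop where
  | mk {G : Game α} : (∀ G', IsOption G' G → Odd G') → Even G

/-- A game is odd if it is composite and all of its options are even. -/
inductive Odd {α : Type} : Game α → Prop where
  | mk {G : Game α} : G.IsComposite → (∀ G', IsOption G' G → Even G') → Odd G
end

/-- A game has parity if it is even or odd. -/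
def HasParity (G : Game α) : Prop := Even G ∨ Odd G

/-- `G` and `H` have matching parity (both even or both odd). -/
def MatchingParity (G H : Game α) : Prop := (Even G ∧ Even H) ∨ (Odd G ∧ Odd H)

/-- `G` and `H` have mismatching parity (one even, the other odd). -/
def MismatchParity (G H : Game α) : Prop := (Even G ∧ Odd H) ∨ (Odd G ∧ Even H)

mutual
/-- The intrinsic order `G ≤ H` on games over a poset: every left option `G^L` of `G`
satisfies `G^L ◁ H`, every right option `H^R` of `H` satisfies `G ◁ H^R`, and if
both games are atoms `[g]`, `[h]` then `g ≤ h`. -/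
inductive Le {α : Type} [PartialOrder α] : Game α → Game α → Prop where
  | mk {G H : Game α} :
      (∀ G', IsLeftOption G' G → Tri G' H) →
      (∀ H', IsRightOption H' H → Tri G H') →
      (∀ g h, G = atom g → H = atom h → g ≤ h) →
      Le G H

/-- The intrinsic relation `G ◁ H` on games over a poset: some right option `G^R` of `G`
satisfies `G^R ≤ H`, or some left option `H^L` of `H` satisfies `G ≤ H^L`. -/
inductive Tri {α : Type} [PartialOrder α] : Game α → Game α → Prop where
  | inr {G H G' : Game α} : IsRightOption G' G → Le G' H → Tri G H
  | inl {G H H' : Game α} : IsLeftOption H' H → Le G H' → Tri G H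
end

/-- The comparison game `λ(Gᵒᵖ + H)`, a game over the boolean poset, where
`λ : αᵒᵈ × α → 𝔹` is the monotone map with `λ(xᵒᵖ, y) = ⊤` iff `x ≤ y`. -/
noncomputable def comparison [PartialOrder α] (G H : Game α) : Game Bool :=
  map (fun p : αᵒᵈ × α => @decide (OrderDual.ofDual p.1 ≤ p.2) (Classical.propDecidable _))
    (G.dual.add H)

/-- A game is locally premotive if Left has a first player winning strategy in
the comparison game `λ(Gᵒᵖ + G)`. -/
def LocallyPremotive [PartialOrder α] (G : Game α) : Prop := LeftWinsFirst (comparison G G)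

/-- A game is premotive if it and all of its followers are locally premotive. -/
def Premotive [PartialOrder α] (G : Game α) : Prop :=
  ∀ G', IsFollower G' G → LocallyPremotive G'

/-- The game `* = ⟨0|0⟩` over the one-element poset. -/
def star : Game Unit := comp Unit Unit (fun _ => atom ()) (fun _ => atom ()) ⟨()⟩ ⟨()⟩

/-- `G + *`, identified with a game over `α` via the isomorphism `α × 1 ≅ α`. -/
noncomputable def addStar (G : Game α) : Game α := map Prod.fst (G.add star)

/-- A game is locally `*`-antimonotone if `G^L + * ≤ G ≤ G^R + *` for all left and
right options `G^L`, `G^R`. -/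
def LocallyStarAnti [PartialOrder α] (G : Game α) : Prop :=
  (∀ G', IsLeftOption G' G → Le G'.addStar G) ∧ (∀ G', IsRightOption G' G → Le G G'.addStar)

/-- A game is `*`-antimonotone if it and all of its followers are locally
`*`-antimonotone. -/
def StarAnti [PartialOrder α] (G : Game α) : Prop :=
  ∀ G', IsFollower G' G → LocallyStarAnti G'

/-- `ε(G + X)`: the game `G` over `α` embedded in a context `X`, a game over the poset
`[α, 𝔹]` of monotone functions `α → 𝔹`, via the application map `ε(a, f) = f a`. -/
noncomputable def ctxSum [PartialOrder α] (G : Game α) (X : Game (α →o Bool)) : Game Bool :=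
  map (fun p : α × (α →o Bool) => p.2 p.1) (G.add X)

/-- The outcome `(o_L(G), o_R(G)) ∈ 𝔹 × 𝔹` of a game over the boolean poset:
`o_L(G) = ⊤` iff Left has a first player winning strategy and `o_R(G) = ⊤` iff
Left has a second player winning strategy. -/
noncomputable def outcome (G : Game Bool) : Bool × Bool :=
  (@decide (LeftWinsFirst G) (Classical.propDecidable _),
   @decide (LeftWinsSecond G) (Classical.propDecidable _))

/-- The contextual order `G ≤_c H`: `o(G+X) ≤ o(H+X)` for every context `X`. -/
def ContextualLe [PartialOrder α] (G H : Game α) : Prop :=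
  ∀ X : Game (α →o Bool), outcome (ctxSum G X) ≤ outcome (ctxSum H X)

/-- The contextual relation `G ◁_c H`: `o_R(G+X) ≤ o_L(H+X)` for every context `X`. -/
def ContextualTri [PartialOrder α] (G H : Game α) : Prop :=
  ∀ X : Game (α →o Bool), (outcome (ctxSum G X)).2 ≤ (outcome (ctxSum H X)).1

/-- Two games are identical when they are equal as set-based games: both are the same
atom, or both are composite with identical sets of left options and identical sets of
right options (recursively). -/
def Identical : Game α → Game α → Prop
  | atom a, atom b => a = b
  | comp _ _ L R _ _, comp _ _ L' R' _ _ =>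
      ((∀ i, ∃ i', Identical (L i) (L' i')) ∧ (∀ i', ∃ i, Identical (L i) (L' i'))) ∧
      ((∀ k, ∃ k', Identical (R k) (R' k')) ∧ (∀ k', ∃ k, Identical (R k) (R' k')))
  | _, _ => False

theorem add_left_iff {X : Game (α × β)} (G : Game α) (H : Game β) :
    IsLeftOption X (add G H) ↔
      (∃ G', IsLeftOption G' G ∧ add G' H = X) ∨ (∃ H', IsLeftOption H' H ∧ add G H' = X) := by
  cases G <;> cases H <;> simp [add, IsLeftOption]

theorem add_right_iff {X : Game (α × β)} (G : Game α) (H : Game β) :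
    IsRightOption X (add G H) ↔
      (∃ G', IsRightOption G' G ∧ add G' H = X) ∨ (∃ H', IsRightOption H' H ∧ add G H' = X) := by
  cases G <;> cases H <;> simp [add, IsRightOption]

theorem add_eq_atom {x : α × β} (G : Game α) (H : Game β) (h : add G H = atom x) :
    G = atom x.1 ∧ H = atom x.2 := by
  cases G <;> cases H <;> simp [add] at h
  subst h
  exact ⟨rfl, rfl⟩

/-- Inner induction, on the derivation for the second summand. -/
theorem add_inner [PartialOrder α] [PartialOrder β] {G G' : Game α}
    (h1 : ∀ K, IsLeftOption K G → ∀ H H' : Game β, Le H H' → Tri (add K H) (add G' H'))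
    (h2 : ∀ K, IsRightOption K G' → ∀ H H' : Game β, Le H H' → Tri (add G H) (add K H'))
    (h3 : ∀ g h, G = atom g → G' = atom h → g ≤ h) :
    (∀ H H' : Game β, Le H H' → Le (add G H) (add G' H')) ∧
    (∀ H H' : Game β, Tri H H' → Tri (add G H) (add G' H')) := by
  have hmk : ∀ {H H' : Game β} (a1 : ∀ K, IsLeftOption K H → Tri K H')
      (a2 : ∀ K, IsRightOption K H' → Tri H K)
      (a3 : ∀ g h, H = atom g → H' = atom h → g ≤ h)
      (_ : ∀ K (hK : IsLeftOption K H), Tri (add G K) (add G' H'))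
      (_ : ∀ K (hK : IsRightOption K H'), Tri (add G H) (add G' K)),
      Le (add G H) (add G' H') := by
    intro H H' a1 a2 a3 i1 i2
    have hle : Le H H' := .mk a1 a2 a3
    refine .mk ?_ ?_ ?_
    · intro X hX
      rcases (add_left_iff G H).1 hX with ⟨K, hK, rfl⟩ | ⟨K, hK, rfl⟩
      · exact h1 K hK _ _ hle
      · exact i1 K hK
    · intro X hX
      rcases (add_right_iff G' H').1 hX with ⟨K, hK, rfl⟩ | ⟨K, hK, rfl⟩
      · exact h2 K hK _ _ hle
      · exact i2 K hK
    · intro x y hx hy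
      obtain ⟨e1, e2⟩ := add_eq_atom _ _ hx
      obtain ⟨e3, e4⟩ := add_eq_atom _ _ hy
      exact ⟨h3 _ _ e1 e3, a3 _ _ e2 e4⟩
  have hr : ∀ {H H' K : Game β}, IsRightOption K H → Le K H' →
      Le (add G K) (add G' H') → Tri (add G H) (add G' H') := fun {H _ K} hK _ ih =>
    .inr ((add_right_iff G H).2 (.inr ⟨K, hK, rfl⟩)) ih
  have hl : ∀ {H H' K : Game β}, IsLeftOption K H' → Le H K →
      Le (add G H) (add G' K) → Tri (add G H) (add G' H') := fun {_ H' K} hK _ ih =>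
    .inl ((add_left_iff G' H').2 (.inr ⟨K, hK, rfl⟩)) ih
  constructor
  · intro H H' h
    exact Le.rec (motive_1 := fun H H' _ => Le (add G H) (add G' H'))
      (motive_2 := fun H H' _ => Tri (add G H) (add G' H')) hmk hr hl h
  · intro H H' h
    exact Tri.rec (motive_1 := fun H H' _ => Le (add G H) (add G' H'))
      (motive_2 := fun H H' _ => Tri (add G H) (add G' H')) hmk hr hl h

/-- The intrinsic order is preserved by sums. -/
theorem sum_preserves_order {α β : Type} [PartialOrder α] [PartialOrder β]
    (G G' : Game α) (H H' : Game β) :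
    (Le G G' → Le H H' → Le (add G H) (add G' H')) ∧
    (Tri G G' → Le H H' → Tri (add G H) (add G' H')) ∧
    (Le G G' → Tri H H' → Tri (add G H) (add G' H')) := by
  have hmk : ∀ {G G' : Game α} (_ : ∀ K, IsLeftOption K G → Tri K G')
      (_ : ∀ K, IsRightOption K G' → Tri G K)
      (_ : ∀ g h, G = atom g → G' = atom h → g ≤ h)
      (_ : ∀ K (hK : IsLeftOption K G), ∀ H H' : Game β, Le H H' → Tri (add K H) (add G' H'))
      (_ : ∀ K (hK : IsRightOption K G'), ∀ H H' : Game β, Le H H' → Tri (add G H) (add K H')),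
      (∀ H H' : Game β, Le H H' → Le (add G H) (add G' H')) ∧
      (∀ H H' : Game β, Tri H H' → Tri (add G H) (add G' H')) :=
    fun _ _ a3 i1 i2 => add_inner i1 i2 a3
  have hr : ∀ {G G' K : Game α}, IsRightOption K G → Le K G' →
      ((∀ H H' : Game β, Le H H' → Le (add K H) (add G' H')) ∧
      (∀ H H' : Game β, Tri H H' → Tri (add K H) (add G' H'))) →
      ∀ H H' : Game β, Le H H' → Tri (add G H) (add G' H') := fun {G _ K} hK _ ih H H' h =>
    .inr ((add_right_iff G H).2 (.inl ⟨K, hK, rfl⟩)) (ih.1 H H' h)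
  have hl : ∀ {G G' K : Game α}, IsLeftOption K G' → Le G K →
      ((∀ H H' : Game β, Le H H' → Le (add G H) (add K H')) ∧
      (∀ H H' : Game β, Tri H H' → Tri (add G H) (add K H'))) →
      ∀ H H' : Game β, Le H H' → Tri (add G H) (add G' H') := fun {_ G' K} hK _ ih H H' h =>
    .inl ((add_left_iff G' H').2 (.inl ⟨K, hK, rfl⟩)) (ih.1 H H' h)
  have key1 := fun h : Le G G' => Le.rec
    (motive_1 := fun G G' _ => (∀ H H' : Game β, Le H H' → Le (add G H) (add G' H')) ∧
      (∀ H H' : Game β, Tri H H' → Tri (add G H) (add G' H')))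
    (motive_2 := fun G G' _ => ∀ H H' : Game β, Le H H' → Tri (add G H) (add G' H')) hmk hr hl h
  have key2 := fun h : Tri G G' => Tri.rec
    (motive_1 := fun G G' _ => (∀ H H' : Game β, Le H H' → Le (add G H) (add G' H')) ∧
      (∀ H H' : Game β, Tri H H' → Tri (add G H) (add G' H')))
    (motive_2 := fun G G' _ => ∀ H H' : Game β, Le H H' → Tri (add G H) (add G' H')) hmk hr hl h
  exact ⟨fun h h' => (key1 h).1 H H' h', fun h h' => key2 h H H' h', fun h h' => (key1 h).2 H H' h'⟩

end Game
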